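/- arXiv:1505.05548 — 3 statements merged into one kernel-verified Lean document; each statement's English description precedes it below -/
import Mathlib

section
/- Suppose λ > 0, μ > 0 and Γ > 0 are real numbers with λ > 2·max{Γ, 1/μ}, and suppose w ∈ L¹(ℝ) satisfies |w(ξ)| ≤ Γ·exp(−μ|ξ|) for all ξ ∈ ℝ. Then there exists ψ ∈ L¹(ℝ) such that ψ(ξ) = R[ψ](ξ) for all ξ ∈ ℝ, |ψ(ξ)| ≤ (1 + 2Γ/λ)·Γ·exp(−μ|ξ|) for all |ξ| ≤ √2·λ, and |ψ(ξ)| ≤ (1 + 4Γ/λ)·Γ·exp(−(μ − 1/(2πλ))·|ξ|) for all ξ ∈ ℝ. -/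
open MeasureTheory Filter

noncomputable section

/-- The Fourier transform `f̂(ξ) = ∫ exp(−i x ξ) f(x) dx` of a real-valued function. -/
def FT (f : ℝ → ℝ) (ξ : ℝ) : ℂ :=
  ∫ x : ℝ, Complex.exp (-(Complex.I * (x:ℂ) * (ξ:ℂ))) * (f x : ℂ)

/-- Convolution of two complex-valued functions on `ℝ`. -/
def conv (f g : ℝ → ℂ) (ξ : ℝ) : ℂ := ∫ η : ℝ, f (ξ - η) * g η

/-- `convIter ψ n = ψ^{*(n+1)}`, the `(n+1)`-fold convolution of `ψ` with itself. -/
def convIter (ψ : ℝ → ℂ) : ℕ → ℝ → ℂ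
  | 0 => ψ
  | n + 1 => conv (convIter ψ n) ψ

/-- `exp₁*[ψ](ξ) = Σ_{n=1}^∞ ψ^{*n}(ξ)/(n!·(2π)^{n−1})`. -/
def exp1star (ψ : ℝ → ℂ) (ξ : ℝ) : ℂ :=
  ∑' n : ℕ, convIter ψ n ξ / ((Nat.factorial (n + 1) : ℂ) * ((2 * Real.pi : ℝ) : ℂ) ^ n)

/-- `exp₂*[ψ](ξ) = Σ_{n=2}^∞ ψ^{*n}(ξ)/(n!·(2π)^{n−1})`. -/
def exp2star (ψ : ℝ → ℂ) (ξ : ℝ) : ℂ :=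
  ∑' n : ℕ, convIter ψ (n + 1) ξ / ((Nat.factorial (n + 2) : ℂ) * ((2 * Real.pi : ℝ) : ℂ) ^ (n + 1))

/-- `W_b[f](ξ) = f(ξ)·b̂(ξ)/(4λ² − ξ²)`. -/
def Wb (lam : ℝ) (b : ℝ → ℝ) (f : ℝ → ℂ) (ξ : ℝ) : ℂ :=
  f ξ * ((b ξ : ℝ) : ℂ) / (((4 * lam ^ 2 - ξ ^ 2 : ℝ)) : ℂ)

/-- `W̃_b[f](ξ) = −iξ·f(ξ)·b̂(ξ)/(4λ² − ξ²)`. -/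
def Wtb (lam : ℝ) (b : ℝ → ℝ) (f : ℝ → ℂ) (ξ : ℝ) : ℂ :=
  -(Complex.I * (ξ:ℂ)) * f ξ * ((b ξ : ℝ) : ℂ) / (((4 * lam ^ 2 - ξ ^ 2 : ℝ)) : ℂ)

/-- The nonlinear operator
`R[f](ξ) = (1/(8π))·(W̃_b[f] * W̃_b[f])(ξ) − 4λ²·exp₂*[W_b[f]](ξ) + w(ξ)`. -/
def Rop (lam : ℝ) (b : ℝ → ℝ) (w : ℝ → ℂ) (f : ℝ → ℂ) (ξ : ℝ) : ℂ :=
  ((1 / (8 * Real.pi) : ℝ) : ℂ) * conv (Wtb lam b f) (Wtb lam b f) ξ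
    - ((4 * lam ^ 2 : ℝ) : ℂ) * exp2star (Wb lam b f) ξ + w ξ

/-- The nonlinear differential operator `S[f](x) = (f′(x))²/4 − 4λ²·(exp(f(x)) − f(x) − 1)`. -/
def Sop (lam : ℝ) (f : ℝ → ℂ) (x : ℝ) : ℂ :=
  (deriv f x) ^ 2 / 4 - ((4 * lam ^ 2 : ℝ) : ℂ) * (Complex.exp (f x) - f x - 1)

/-- The operator `T[f](x) = (1/2π)·∫ exp(i x ξ)·f̂(ξ)/(4λ² − ξ²) dξ`. -/
def OpT (lam : ℝ) (f : ℝ → ℝ) (x : ℝ) : ℂ :=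
  ((1 / (2 * Real.pi) : ℝ) : ℂ) *
    ∫ ξ : ℝ, Complex.exp (Complex.I * (x:ℂ) * (ξ:ℂ)) * FT f ξ / (((4 * lam ^ 2 - ξ ^ 2 : ℝ)) : ℂ)

/-- The band-limited operator `T_b[f](x) = (1/2π)·∫ exp(i x ξ)·f̂(ξ)·b̂(ξ)/(4λ² − ξ²) dξ`,
so that `T_b[f]^(ξ) = f̂(ξ)·b̂(ξ)/(4λ² − ξ²)`. -/
def Tb (lam : ℝ) (b : ℝ → ℝ) (f : ℝ → ℝ) (x : ℝ) : ℂ :=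
  ((1 / (2 * Real.pi) : ℝ) : ℂ) *
    ∫ ξ : ℝ, Complex.exp (Complex.I * (x:ℂ) * (ξ:ℂ)) * FT f ξ * ((b ξ : ℝ) : ℂ) /
      (((4 * lam ^ 2 - ξ ^ 2 : ℝ)) : ℂ)

/-- The Schwarzian derivative `{f, x} = f′′′(x)/f′(x) − (3/2)·(f′′(x)/f′(x))²`. -/
def schwarzian (f : ℝ → ℝ) (x : ℝ) : ℝ :=
  deriv (deriv (deriv f)) x / deriv f x - (3 / 2) * (deriv (deriv f) x / deriv f x) ^ 2

/-- A real-valued function is Schwartz if it agrees with an element of the Schwartz space. -/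
def IsSchwartz (f : ℝ → ℝ) : Prop := ∃ g : SchwartzMap ℝ ℝ, ∀ x, g x = f x

/-- The `L¹(ℝ)` norm `‖f‖₁ = ∫ |f(ξ)| dξ`. -/
def L1norm (f : ℝ → ℂ) : ℝ := ∫ ξ : ℝ, ‖f ξ‖

/-- The modified Bessel function of the second kind,
`K_ν(t) = ∫₀^∞ exp(−t·cosh(s))·cosh(νs) ds`. -/
def besselK (ν t : ℝ) : ℝ :=
  ∫ s in Set.Ioi (0 : ℝ), Real.exp (-t * Real.cosh s) * Real.cosh (ν * s)

/-- Kummer's confluent hypergeometric function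
`M(a,b,z) = Σ_{n=0}^∞ ((a)_n/(b)_n)·zⁿ/n!` with `(a)_n = Γ(a+n)/Γ(a)`. -/
def kummerM (a b z : ℝ) : ℝ :=
  ∑' n : ℕ, (Real.Gamma (a + n) / Real.Gamma a) / (Real.Gamma (b + n) / Real.Gamma b)
      * z ^ n / (Nat.factorial n : ℝ)

/-- The standing hypotheses on the bump function `b̂`: it is smooth, compactly supported,
equal to `1` on `[−λ, λ]`, takes values in `[0, 1]`, and is supported inside
`(−√2·λ, √2·λ)`. -/
def BumpHyp (lam : ℝ) (b : ℝ → ℝ) : Prop :=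
  ContDiff ℝ (⊤ : ℕ∞) b ∧ HasCompactSupport b ∧
    (∀ ξ : ℝ, |ξ| ≤ lam → b ξ = 1) ∧ (∀ ξ : ℝ, 0 ≤ b ξ ∧ b ξ ≤ 1) ∧
    tsupport b ⊆ Set.Ioo (-(Real.sqrt 2 * lam)) (Real.sqrt 2 * lam)


theorem integral_exp_neg_mul_abs {p : ℝ} (hp : 0 < p) :
    ∫ x : ℝ, Real.exp (-p * |x|) = 2 / p := by
  rw [integral_comp_abs (f := fun x => Real.exp (-p * x)), integral_exp_mul_Ioi (by linarith)]
  simp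
  ring

theorem integrable_exp_neg_mul_abs {p : ℝ} (hp : 0 < p) :
    Integrable fun x : ℝ => Real.exp (-p * |x|) := by
  refine Integrable.of_integral_ne_zero ?_
  rw [integral_exp_neg_mul_abs hp]
  positivity

theorem integrable_exp_mul_exp_abs {p q : ℝ} (hp : 0 ≤ p) (hq : 0 < q) (x : ℝ) :
    Integrable fun y : ℝ => Real.exp (-p * |x - y|) * Real.exp (-q * |y|) := by
  refine (integrable_exp_neg_mul_abs hq).bdd_mul (c := 1)
    (Continuous.aestronglyMeasurable (by fun_prop)) (.of_forall fun y => ?_)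
  rw [Real.norm_eq_abs, Real.abs_exp]
  exact Real.exp_le_one_iff.2 (by nlinarith [mul_nonneg hp (abs_nonneg (x - y))])

theorem integral_exp_mul_exp_abs_le_of_nonneg {p c x : ℝ} (hc : 0 < c) (hcp : c ≤ p)
    (hx : 0 ≤ x) :
    ∫ y : ℝ, Real.exp (-(p - c) * |x - y|) * Real.exp (-p * |y|)
      ≤ (1 / c + 1 / (2 * p - c)) * Real.exp (-(p - c) * |x|) := by
  have hi := integrable_exp_mul_exp_abs (sub_nonneg.2 hcp) (hc.trans_le hcp) x
  have hs : 0 < 2 * p - c := by linarith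
  have hneg : ∫ y in Set.Iic 0, Real.exp (-(p - c) * |x - y|) * Real.exp (-p * |y|)
      = Real.exp (-(p - c) * x) / (2 * p - c) := by
    have : ∀ y ∈ Set.Iic (0 : ℝ), Real.exp (-(p - c) * |x - y|) * Real.exp (-p * |y|)
        = Real.exp (-(p - c) * x) * Real.exp ((2 * p - c) * y) := by
      intro y hy
      have hy : y ≤ 0 := hy
      rw [abs_of_nonneg (by linarith), abs_of_nonpos hy, ← Real.exp_add, ← Real.exp_add]
      ring_nf
    rw [setIntegral_congr_fun measurableSet_Iic this, integral_const_mul,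
      integral_exp_mul_Iic hs]
    simp [div_eq_mul_inv]
  have hmid : ∫ y in Set.Ioc 0 x, Real.exp (-(p - c) * |x - y|) * Real.exp (-p * |y|)
      = (Real.exp (-(p - c) * x) - Real.exp (-p * x)) / c := by
    have : ∀ y ∈ Set.Ioc 0 x, Real.exp (-(p - c) * |x - y|) * Real.exp (-p * |y|)
        = Real.exp (-(p - c) * x) * Real.exp (-c * y) := by
      intro y hy
      rw [abs_of_nonneg (by linarith [hy.2]), abs_of_nonneg hy.1.le, ← Real.exp_add,
        ← Real.exp_add]
      ring_nf
    rw [setIntegral_congr_fun measurableSet_Ioc this, integral_const_mul,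
      ← intervalIntegral.integral_of_le hx,
      intervalIntegral.integral_comp_mul_left (fun y => Real.exp y) (neg_ne_zero.2 hc.ne'),
      integral_exp]
    have : Real.exp (-p * x) = Real.exp (-(p - c) * x) * Real.exp (-c * x) := by
      rw [← Real.exp_add]; ring_nf
    rw [this]
    simp
    field_simp
    ring
  have hpos : ∫ y in Set.Ioi x, Real.exp (-(p - c) * |x - y|) * Real.exp (-p * |y|)
      = Real.exp (-p * x) / (2 * p - c) := by
    have : ∀ y ∈ Set.Ioi x, Real.exp (-(p - c) * |x - y|) * Real.exp (-p * |y|)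
        = Real.exp ((p - c) * x) * Real.exp (-(2 * p - c) * y) := by
      intro y hy
      have hy : x < y := hy
      rw [abs_of_nonpos (by linarith), abs_of_nonneg (hx.trans hy.le), ← Real.exp_add,
        ← Real.exp_add]
      ring_nf
    rw [setIntegral_congr_fun measurableSet_Ioi this, integral_const_mul,
      integral_exp_mul_Ioi (by linarith)]
    have : Real.exp (-p * x) = Real.exp ((p - c) * x) * Real.exp (-(2 * p - c) * x) := by
      rw [← Real.exp_add]; ring_nf
    rw [this, neg_div_neg_eq]
    ring
  rw [← intervalIntegral.integral_Iic_add_Ioi hi.integrableOn hi.integrableOn (b := 0),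
    ← Set.Ioc_union_Ioi_eq_Ioi hx, setIntegral_union Set.Ioc_disjoint_Ioi_same
      measurableSet_Ioi hi.integrableOn hi.integrableOn, hneg, hmid, hpos, abs_of_nonneg hx]
  have : Real.exp (-p * x) * (1 / (2 * p - c)) ≤ Real.exp (-p * x) * (1 / c) := by
    gcongr
    linarith
  linear_combination this

theorem integral_exp_mul_exp_abs_le {p c : ℝ} (hc : 0 < c) (hcp : c ≤ p) (x : ℝ) :
    ∫ y : ℝ, Real.exp (-(p - c) * |x - y|) * Real.exp (-p * |y|)
      ≤ (1 / c + 1 / (2 * p - c)) * Real.exp (-(p - c) * |x|) := by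
  rcases le_total 0 x with hx | hx
  · exact integral_exp_mul_exp_abs_le_of_nonneg hc hcp hx
  · have h := integral_exp_mul_exp_abs_le_of_nonneg hc hcp (neg_nonneg.2 hx)
    rw [← integral_neg_eq_self, abs_neg] at h
    convert h using 6 with y
    · rw [← abs_neg (x - y)]; ring_nf
    · rw [abs_neg]

theorem norm_conv_le {p q K F G : ℝ} (hp : 0 ≤ p) (hq : 0 < q) (hF : 0 ≤ F)
    (hK : ∀ x : ℝ, ∫ y : ℝ, Real.exp (-p * |x - y|) * Real.exp (-q * |y|)
      ≤ K * Real.exp (-p * |x|))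
    {f g : ℝ → ℂ} (hf : ∀ x, ‖f x‖ ≤ F * Real.exp (-p * |x|))
    (hg : ∀ x, ‖g x‖ ≤ G * Real.exp (-q * |x|)) (x : ℝ) :
    ‖conv f g x‖ ≤ F * G * K * Real.exp (-p * |x|) := by
  have hG : 0 ≤ G := by simpa using (norm_nonneg _).trans (hg 0)
  calc ‖conv f g x‖
      ≤ ∫ y, F * G * (Real.exp (-p * |x - y|) * Real.exp (-q * |y|)) := by
        refine norm_integral_le_of_norm_le
          ((integrable_exp_mul_exp_abs hp hq x).const_mul _) (.of_forall fun y => ?_)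
        rw [norm_mul]
        calc _ ≤ (F * Real.exp (-p * |x - y|)) * (G * Real.exp (-q * |y|)) :=
              mul_le_mul (hf _) (hg _) (norm_nonneg _) (by positivity)
          _ = _ := by ring
    _ ≤ F * G * (K * Real.exp (-p * |x|)) := by
        rw [integral_const_mul]
        gcongr
        exact hK x
    _ = _ := by ring

theorem norm_convIter_le {p q K M : ℝ} (hp : 0 ≤ p) (hpq : p ≤ q) (hq : 0 < q) (hK0 : 0 ≤ K)
    (hK : ∀ x : ℝ, ∫ y : ℝ, Real.exp (-p * |x - y|) * Real.exp (-q * |y|)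
      ≤ K * Real.exp (-p * |x|))
    {u : ℝ → ℂ} (hu : ∀ x, ‖u x‖ ≤ M * Real.exp (-q * |x|)) (n : ℕ) (x : ℝ) :
    ‖convIter u n x‖ ≤ M * (M * K) ^ n * Real.exp (-p * |x|) := by
  have hM : 0 ≤ M := by simpa using (norm_nonneg _).trans (hu 0)
  induction n generalizing x with
  | zero =>
    refine (hu x).trans ?_
    rw [pow_zero, mul_one]
    gcongr
  | succ n ih =>
    refine (norm_conv_le hp hq (by positivity) hK ih hu x).trans_eq ?_
    ring

theorem integrable_conv {f g : ℝ → ℂ} (hf : Integrable f) (hg : Integrable g) :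
    Integrable (conv f g) := by
  have h := hg.integrable_convolution (ContinuousLinearMap.mul ℝ ℂ) hf
  refine h.congr (.of_forall fun x => ?_)
  simp [conv, convolution, mul_comm]

theorem integrable_convIter {u : ℝ → ℂ} (hu : Integrable u) (n : ℕ) :
    Integrable (convIter u n) := by
  induction n with
  | zero => exact hu
  | succ n ih => exact integrable_conv ih hu

theorem integrable_conv_integrand {f g : ℝ → ℂ} {F : ℝ} (hf : Integrable f)
    (hF : ∀ x, ‖f x‖ ≤ F) (hg : Integrable g) (x : ℝ) :
    Integrable fun y => f (x - y) * g y :=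
  hg.bdd_mul (c := F) (hf.comp_sub_left x).aestronglyMeasurable (.of_forall fun _ => hF _)

theorem norm_conv_le_of_bound_left {p D G : ℝ} (hp : 0 < p) {f g : ℝ → ℂ}
    (hf : ∀ x, ‖f x‖ ≤ D) (hg : ∀ x, ‖g x‖ ≤ G * Real.exp (-p * |x|)) (x : ℝ) :
    ‖conv f g x‖ ≤ D * (G * (2 / p)) := by
  have hD : 0 ≤ D := (norm_nonneg _).trans (hf 0)
  rw [← integral_exp_neg_mul_abs hp, ← integral_const_mul, ← integral_const_mul]
  refine norm_integral_le_of_norm_le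
    (((integrable_exp_neg_mul_abs hp).const_mul _).const_mul _) (.of_forall fun y => ?_)
  rw [norm_mul]
  exact mul_le_mul (hf _) (hg _) (norm_nonneg _) hD

theorem conv_comm (f g : ℝ → ℂ) : conv f g = conv g f := by
  ext x
  rw [conv, conv, ← integral_sub_left_eq_self _ volume x]
  simp [mul_comm]

theorem norm_convIter_sub_le {p q K M D : ℝ} (hp : 0 < p) (hpq : p ≤ q)
    (hK : ∀ x : ℝ, ∫ y : ℝ, Real.exp (-p * |x - y|) * Real.exp (-q * |y|)
      ≤ K * Real.exp (-p * |x|)) (hpK : 2 / p ≤ K)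
    {u v : ℝ → ℂ} (hu : ∀ x, ‖u x‖ ≤ M * Real.exp (-q * |x|))
    (hv : ∀ x, ‖v x‖ ≤ M * Real.exp (-q * |x|)) (hui : Integrable u) (hvi : Integrable v)
    (huv : ∀ x, ‖u x - v x‖ ≤ D) (n : ℕ) (x : ℝ) :
    ‖convIter u n x - convIter v n x‖ ≤ (n + 1) * D * (M * K) ^ n := by
  have hM : 0 ≤ M := by simpa using (norm_nonneg _).trans (hu 0)
  have hD : 0 ≤ D := (norm_nonneg _).trans (huv 0)
  have hq : 0 < q := hp.trans_le hpq
  have hK0 : 0 ≤ K := le_trans (by positivity) hpK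
  induction n generalizing x with
  | zero => simpa [convIter] using huv x
  | succ n ih =>
    have hle : ∀ {C r : ℝ}, 0 ≤ C → 0 ≤ r → ∀ y : ℝ, C * Real.exp (-r * |y|) ≤ C :=
      fun hC hr y => mul_le_of_le_one_right hC (Real.exp_le_one_iff.2
        (by nlinarith [mul_nonneg hr (abs_nonneg y)]))
    have hun := norm_convIter_le hp.le hpq hq hK0 hK hu n
    have hvn := norm_convIter_le hp.le hpq hq hK0 hK hv n
    have hC : 0 ≤ M * (M * K) ^ n := by positivity
    have e : convIter u (n + 1) x - convIter v (n + 1) x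
        = conv (fun y => convIter u n y - convIter v n y) u x
          + conv (fun y => u y - v y) (convIter v n) x := by
      rw [conv_comm (fun y => u y - v y)]
      simp only [convIter, conv]
      rw [← integral_sub, ← integral_add]
      · congr 1; ext y; ring
      · exact integrable_conv_integrand ((integrable_convIter hui n).sub
          (integrable_convIter hvi n)) ih hui x
      · exact integrable_conv_integrand (integrable_convIter hvi n)
          (fun y => (hvn y).trans (hle hC hp.le y)) (hui.sub hvi) x
      · exact integrable_conv_integrand (integrable_convIter hui n)
          (fun y => (hun y).trans (hle hC hp.le y)) hui x
      · exact integrable_conv_integrand (integrable_convIter hvi n)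
          (fun y => (hvn y).trans (hle hC hp.le y)) hvi x
    have hqK : 2 / q ≤ K := le_trans (by gcongr) hpK
    calc ‖convIter u (n + 1) x - convIter v (n + 1) x‖
        ≤ ((n + 1) * D * (M * K) ^ n) * (M * (2 / q))
          + D * (M * (M * K) ^ n * (2 / p)) := by
          rw [e]
          exact (norm_add_le _ _).trans (add_le_add (norm_conv_le_of_bound_left hq ih hu x)
            (norm_conv_le_of_bound_left hp huv hvn x))
      _ ≤ ((n + 1) * D * (M * K) ^ n) * (M * K) + D * (M * (M * K) ^ n * K) := by
          gcongr
      _ = _ := by push_cast; ring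

theorem two_mul_three_pow_le_factorial (n : ℕ) : (2 * 3 ^ n : ℝ) ≤ (n + 2).factorial := by
  have h : Nat.factorial 2 * (2 + 1) ^ n ≤ (2 + n).factorial := Nat.factorial_mul_pow_le_factorial
  rw [add_comm n 2]
  exact_mod_cast h

theorem two_pow_le_factorial (n : ℕ) : (2 ^ n : ℝ) ≤ (n + 1).factorial := by
  have h : Nat.factorial 1 * (1 + 1) ^ n ≤ (1 + n).factorial := Nat.factorial_mul_pow_le_factorial
  rw [add_comm n 1]
  rw [Nat.factorial_one, one_mul] at h
  exact_mod_cast h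

theorem norm_exp2star_denom (n : ℕ) :
    ‖((Nat.factorial (n + 2) : ℂ) * ((2 * Real.pi : ℝ) : ℂ) ^ (n + 1))‖
      = (n + 2).factorial * (2 * Real.pi) ^ (n + 1) := by
  rw [norm_mul, norm_pow, Complex.norm_natCast, Complex.norm_real, Real.norm_eq_abs,
    abs_of_pos Real.two_pi_pos]

section Exp2star

variable {p q K M r : ℝ} {u v : ℝ → ℂ}

theorem norm_exp2star_term_le (hp : 0 ≤ p) (hpq : p ≤ q) (hq : 0 < q) (hK0 : 0 ≤ K)
    (hK : ∀ x : ℝ, ∫ y : ℝ, Real.exp (-p * |x - y|) * Real.exp (-q * |y|)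
      ≤ K * Real.exp (-p * |x|))
    (hu : ∀ x, ‖u x‖ ≤ M * Real.exp (-q * |x|)) (hr : M * K = 2 * Real.pi * r)
    (n : ℕ) (x : ℝ) :
    ‖convIter u (n + 1) x / ((Nat.factorial (n + 2) : ℂ) * ((2 * Real.pi : ℝ) : ℂ) ^ (n + 1))‖
      ≤ M * Real.exp (-p * |x|) * (r / 2) * (r / 3) ^ n := by
  have hM : 0 ≤ M := by simpa using (norm_nonneg _).trans (hu 0)
  have hr0 : 0 ≤ r := by
    have : 0 ≤ 2 * Real.pi * r := hr ▸ mul_nonneg hM hK0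
    exact nonneg_of_mul_nonneg_right this Real.two_pi_pos
  rw [norm_div, norm_exp2star_denom]
  have hπ := Real.pi_pos
  calc _ ≤ M * (M * K) ^ (n + 1) * Real.exp (-p * |x|)
        / ((n + 2).factorial * (2 * Real.pi) ^ (n + 1)) := by
        gcongr
        exact norm_convIter_le hp hpq hq hK0 hK hu (n + 1) x
    _ = M * r ^ (n + 1) * Real.exp (-p * |x|) / (n + 2).factorial := by
        rw [hr, mul_pow]
        field_simp
    _ ≤ M * r ^ (n + 1) * Real.exp (-p * |x|) / (2 * 3 ^ n) := by
        gcongr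
        exact two_mul_three_pow_le_factorial n
    _ = _ := by
        rw [div_pow, pow_succ]
        field_simp

theorem summable_exp2star (hp : 0 ≤ p) (hpq : p ≤ q) (hq : 0 < q) (hK0 : 0 ≤ K)
    (hK : ∀ x : ℝ, ∫ y : ℝ, Real.exp (-p * |x - y|) * Real.exp (-q * |y|)
      ≤ K * Real.exp (-p * |x|))
    (hu : ∀ x, ‖u x‖ ≤ M * Real.exp (-q * |x|)) (hr : M * K = 2 * Real.pi * r)
    (hr0 : 0 ≤ r) (hr3 : r < 3) (x : ℝ) :
    Summable fun n : ℕ => convIter u (n + 1) x /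
      ((Nat.factorial (n + 2) : ℂ) * ((2 * Real.pi : ℝ) : ℂ) ^ (n + 1)) :=
  .of_norm_bounded ((summable_geometric_of_lt_one (by positivity) (by linarith)).mul_left _)
    fun n => norm_exp2star_term_le hp hpq hq hK0 hK hu hr n x

theorem norm_exp2star_le (hp : 0 ≤ p) (hpq : p ≤ q) (hq : 0 < q) (hK0 : 0 ≤ K)
    (hK : ∀ x : ℝ, ∫ y : ℝ, Real.exp (-p * |x - y|) * Real.exp (-q * |y|)
      ≤ K * Real.exp (-p * |x|))
    (hu : ∀ x, ‖u x‖ ≤ M * Real.exp (-q * |x|)) (hr : M * K = 2 * Real.pi * r)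
    (hr0 : 0 ≤ r) (hr3 : r < 3) (x : ℝ) :
    ‖exp2star u x‖ ≤ M * Real.exp (-p * |x|) * (r / 2) * (1 - r / 3)⁻¹ :=
  tsum_of_norm_bounded
    ((hasSum_geometric_of_lt_one (by positivity) (by linarith)).mul_left _)
    fun n => norm_exp2star_term_le hp hpq hq hK0 hK hu hr n x

theorem aestronglyMeasurable_exp2star (hp : 0 ≤ p) (hpq : p ≤ q) (hq : 0 < q) (hK0 : 0 ≤ K)
    (hK : ∀ x : ℝ, ∫ y : ℝ, Real.exp (-p * |x - y|) * Real.exp (-q * |y|)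
      ≤ K * Real.exp (-p * |x|))
    (hu : ∀ x, ‖u x‖ ≤ M * Real.exp (-q * |x|)) (hr : M * K = 2 * Real.pi * r)
    (hr0 : 0 ≤ r) (hr3 : r < 3) (hui : Integrable u) :
    AEStronglyMeasurable (exp2star u) := by
  refine aestronglyMeasurable_of_tendsto_ae atTop
    (f := fun N x => ∑ n ∈ Finset.range N, convIter u (n + 1) x /
      ((Nat.factorial (n + 2) : ℂ) * ((2 * Real.pi : ℝ) : ℂ) ^ (n + 1))) (fun N => ?_)
    (.of_forall fun x =>
      (summable_exp2star hp hpq hq hK0 hK hu hr hr0 hr3 x).hasSum.tendsto_sum_nat)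
  refine Finset.aestronglyMeasurable_fun_sum _ fun n _ => ?_
  exact ((integrable_convIter hui (n + 1)).div_const _).aestronglyMeasurable

theorem norm_exp2star_sub_le {D : ℝ} (hp : 0 < p) (hpq : p ≤ q)
    (hK : ∀ x : ℝ, ∫ y : ℝ, Real.exp (-p * |x - y|) * Real.exp (-q * |y|)
      ≤ K * Real.exp (-p * |x|)) (hpK : 2 / p ≤ K)
    (hu : ∀ x, ‖u x‖ ≤ M * Real.exp (-q * |x|)) (hv : ∀ x, ‖v x‖ ≤ M * Real.exp (-q * |x|))
    (hui : Integrable u) (hvi : Integrable v) (huv : ∀ x, ‖u x - v x‖ ≤ D)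
    (hr : M * K = 2 * Real.pi * r) (hr0 : 0 ≤ r) (hr2 : r < 2) (x : ℝ) :
    ‖exp2star u x - exp2star v x‖ ≤ D * r * (1 - r / 2)⁻¹ := by
  have hq : 0 < q := hp.trans_le hpq
  have hK0 : 0 ≤ K := le_trans (by positivity) hpK
  have hD : 0 ≤ D := (norm_nonneg _).trans (huv 0)
  rw [exp2star, exp2star,
    ← (summable_exp2star hp.le hpq hq hK0 hK hu hr hr0 (by linarith) x).tsum_sub
      (summable_exp2star hp.le hpq hq hK0 hK hv hr hr0 (by linarith) x)]
  refine tsum_of_norm_bounded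
    ((hasSum_geometric_of_lt_one (by positivity) (by linarith)).mul_left _) fun n => ?_
  rw [← sub_div, norm_div, norm_exp2star_denom]
  have hπ := Real.pi_pos
  calc _ ≤ ((n + 1 : ℕ) + 1) * D * (M * K) ^ (n + 1)
        / ((n + 2).factorial * (2 * Real.pi) ^ (n + 1)) := by
        gcongr
        exact norm_convIter_sub_le hp hpq hK hpK hu hv hui hvi huv (n + 1) x
    _ = D * r ^ (n + 1) / (n + 1).factorial := by
        rw [hr, mul_pow, Nat.factorial_succ (n + 1)]
        push_cast
        field_simp
    _ ≤ D * r ^ (n + 1) / 2 ^ n := by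
        gcongr
        exact two_pow_le_factorial n
    _ = _ := by
        rw [div_pow, pow_succ]
        field_simp

end Exp2star

section Multipliers

variable {lam : ℝ} {b : ℝ → ℝ} {f : ℝ → ℂ} {g : ℝ → ℝ}

theorem BumpHyp.abs_lt_of_ne_zero (hb : BumpHyp lam b) {ξ : ℝ} (h : b ξ ≠ 0) :
    |ξ| < Real.sqrt 2 * lam :=
  abs_lt.2 (hb.2.2.2.2 (subset_tsupport b h))

theorem BumpHyp.norm_Wb_le (hb : BumpHyp lam b) (hlam : 0 < lam) (hg : ∀ ξ, 0 ≤ g ξ)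
    (hf : ∀ ξ, |ξ| ≤ Real.sqrt 2 * lam → ‖f ξ‖ ≤ g ξ) (ξ : ℝ) :
    ‖Wb lam b f ξ‖ ≤ 1 / (2 * lam ^ 2) * g ξ := by
  by_cases h : b ξ = 0
  · have := hg ξ
    simp only [Wb, h, Complex.ofReal_zero, mul_zero, zero_div, norm_zero]
    positivity
  · have hξ := (hb.abs_lt_of_ne_zero h).le
    have hsq : ξ ^ 2 ≤ 2 * lam ^ 2 := by
      have := pow_le_pow_left₀ (abs_nonneg ξ) hξ 2
      rwa [sq_abs, mul_pow, Real.sq_sqrt zero_le_two] at this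
    obtain ⟨hb0, hb1⟩ := hb.2.2.2.1 ξ
    rw [Wb, norm_div, norm_mul, Complex.norm_real, Complex.norm_real, Real.norm_eq_abs,
      Real.norm_eq_abs, abs_of_nonneg hb0, abs_of_pos (by nlinarith : 0 < 4 * lam ^ 2 - ξ ^ 2)]
    calc _ ≤ g ξ * 1 / (2 * lam ^ 2) := by
          gcongr
          · exact mul_nonneg (hg ξ) zero_le_one
          · exact hg ξ
          · exact hf ξ hξ
          · linarith
      _ = _ := by ring

theorem Wtb_eq (lam : ℝ) (b : ℝ → ℝ) (f : ℝ → ℂ) (ξ : ℝ) :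
    Wtb lam b f ξ = -(Complex.I * ξ) * Wb lam b f ξ := by
  rw [Wtb, Wb]
  ring

theorem BumpHyp.norm_Wtb_le (hb : BumpHyp lam b) (hlam : 0 < lam) (hg : ∀ ξ, 0 ≤ g ξ)
    (hf : ∀ ξ, |ξ| ≤ Real.sqrt 2 * lam → ‖f ξ‖ ≤ g ξ) (ξ : ℝ) :
    ‖Wtb lam b f ξ‖ ≤ Real.sqrt 2 / (2 * lam) * g ξ := by
  by_cases h : b ξ = 0
  · have := hg ξ
    simp only [Wtb, h, Complex.ofReal_zero, mul_zero, zero_div, norm_zero]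
    positivity
  · rw [Wtb_eq, norm_mul, norm_neg, norm_mul, Complex.norm_I, one_mul, Complex.norm_real,
      Real.norm_eq_abs]
    calc _ ≤ Real.sqrt 2 * lam * (1 / (2 * lam ^ 2) * g ξ) :=
          mul_le_mul (hb.abs_lt_of_ne_zero h).le (hb.norm_Wb_le hlam hg hf ξ) (norm_nonneg _)
            (by positivity)
      _ = _ := by field_simp

theorem Wb_sub (lam : ℝ) (b : ℝ → ℝ) (f g : ℝ → ℂ) (ξ : ℝ) :
    Wb lam b f ξ - Wb lam b g ξ = Wb lam b (f - g) ξ := by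
  simp only [Wb, Pi.sub_apply]
  ring

theorem Wtb_sub (lam : ℝ) (b : ℝ → ℝ) (f g : ℝ → ℂ) (ξ : ℝ) :
    Wtb lam b f ξ - Wtb lam b g ξ = Wtb lam b (f - g) ξ := by
  rw [Wtb_eq, Wtb_eq, Wtb_eq, ← Wb_sub]
  ring

theorem BumpHyp.aestronglyMeasurable_Wb (hb : BumpHyp lam b) (hf : AEStronglyMeasurable f) :
    AEStronglyMeasurable (Wb lam b f) := by
  refine (hf.mul ?_).mul (f := fun ξ => f ξ * (b ξ : ℂ))
    (g := fun ξ => (((4 * lam ^ 2 - ξ ^ 2 : ℝ)) : ℂ)⁻¹) ?_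
  · exact (Complex.continuous_ofReal.comp hb.1.continuous).aestronglyMeasurable
  · exact Measurable.aestronglyMeasurable (by fun_prop)

theorem BumpHyp.aestronglyMeasurable_Wtb (hb : BumpHyp lam b) (hf : AEStronglyMeasurable f) :
    AEStronglyMeasurable (Wtb lam b f) := by
  rw [funext (Wtb_eq lam b f)]
  exact (Continuous.aestronglyMeasurable (by fun_prop)).mul (hb.aestronglyMeasurable_Wb hf)

end Multipliers

theorem exists_eq_of_half_contraction {α : Type*} (R : (α → ℂ) → α → ℂ) (S : (α → ℂ) → Prop)
    (hmaps : ∀ f, S f → S (R f))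
    (hclosed : ∀ (F : ℕ → α → ℂ) (f : α → ℂ), (∀ n, S (F n)) →
      (∀ x, Tendsto (fun n => F n x) atTop (nhds (f x))) → S f)
    (hcontr : ∀ f g D, S f → S g → (∀ x, ‖f x - g x‖ ≤ D) → ∀ x, ‖R f x - R g x‖ ≤ D / 2)
    {f₀ : α → ℂ} (h₀ : S f₀) {D : ℝ} (hD : ∀ x, ‖f₀ x - R f₀ x‖ ≤ D) :
    ∃ f, S f ∧ ∀ x, f x = R f x := by
  set F : ℕ → α → ℂ := fun n => R^[n] f₀ with hFdef
  have hF : ∀ n, F (n + 1) = R (F n) := fun n => Function.iterate_succ_apply' R n f₀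
  have hS : ∀ n, S (F n) := by
    intro n
    induction n with
    | zero => exact h₀
    | succ n ih => rw [hF]; exact hmaps _ ih
  have hstep : ∀ n x, dist (F n x) (F (n + 1) x) ≤ 2 * D / 2 / 2 ^ n := by
    intro n
    induction n with
    | zero => intro x; rw [hF, dist_eq_norm]; simpa [hFdef] using hD x
    | succ n ih =>
      intro x
      rw [hF (n + 1), hF n, dist_eq_norm]
      refine (hcontr _ _ _ (hS n) (hF n ▸ hS (n + 1)) (fun y => ?_) x).trans_eq
        (b := 2 * D / 2 / 2 ^ n / 2) (by rw [pow_succ]; field_simp)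
      rw [← hF n, ← dist_eq_norm]
      exact ih y
  choose f hf using fun x =>
    cauchySeq_tendsto_of_complete (cauchySeq_of_le_geometric_two fun n => hstep n x)
  have hSf := hclosed F f hS hf
  refine ⟨f, hSf, fun x => tendsto_nhds_unique ((tendsto_add_atTop_iff_nat 1).2 (hf x)) ?_⟩
  have hdist : ∀ n, dist (F (n + 1) x) (R f x) ≤ 2 * D / 2 ^ n / 2 := by
    intro n
    rw [hF, dist_eq_norm]
    refine hcontr _ _ _ (hS n) hSf (fun y => ?_) x
    rw [← dist_eq_norm]
    exact dist_le_of_le_geometric_two_of_tendsto (fun m => hstep m y) (hf y) n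
  refine tendsto_iff_dist_tendsto_zero.2 (squeeze_zero (fun _ => dist_nonneg) hdist ?_)
  have := (tendsto_pow_atTop_nhds_zero_of_lt_one (r := (1 / 2 : ℝ)) (by norm_num)
    (by norm_num)).const_mul D
  rw [mul_zero] at this
  refine this.congr fun n => ?_
  rw [div_pow, one_pow]
  field_simp

section Rop

variable {lam p q A κ : ℝ} {b : ℝ → ℝ} {w f g : ℝ → ℂ}

theorem BumpHyp.norm_Wb_le_exp (hb : BumpHyp lam b) (hlam : 0 < lam) (hA : 0 ≤ A)
    (hf : ∀ ξ, |ξ| ≤ Real.sqrt 2 * lam → ‖f ξ‖ ≤ A * Real.exp (-q * |ξ|)) (ξ : ℝ) :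
    ‖Wb lam b f ξ‖ ≤ A / (2 * lam ^ 2) * Real.exp (-q * |ξ|) :=
  (hb.norm_Wb_le hlam (fun _ => by positivity) hf ξ).trans_eq (by ring)

theorem BumpHyp.norm_Wtb_le_exp (hb : BumpHyp lam b) (hlam : 0 < lam) (hA : 0 ≤ A)
    (hf : ∀ ξ, |ξ| ≤ Real.sqrt 2 * lam → ‖f ξ‖ ≤ A * Real.exp (-q * |ξ|)) (ξ : ℝ) :
    ‖Wtb lam b f ξ‖ ≤ Real.sqrt 2 * A / (2 * lam) * Real.exp (-q * |ξ|) :=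
  (hb.norm_Wtb_le hlam (fun _ => by positivity) hf ξ).trans_eq (by ring)

theorem BumpHyp.integrable_Wb (hb : BumpHyp lam b) (hlam : 0 < lam) (hA : 0 ≤ A) (hq : 0 < q)
    (hfm : AEStronglyMeasurable f)
    (hf : ∀ ξ, |ξ| ≤ Real.sqrt 2 * lam → ‖f ξ‖ ≤ A * Real.exp (-q * |ξ|)) :
    Integrable (Wb lam b f) :=
  ((integrable_exp_neg_mul_abs hq).const_mul _).mono' (hb.aestronglyMeasurable_Wb hfm)
    (.of_forall (hb.norm_Wb_le_exp hlam hA hf))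

theorem BumpHyp.integrable_Wtb (hb : BumpHyp lam b) (hlam : 0 < lam) (hA : 0 ≤ A) (hq : 0 < q)
    (hfm : AEStronglyMeasurable f)
    (hf : ∀ ξ, |ξ| ≤ Real.sqrt 2 * lam → ‖f ξ‖ ≤ A * Real.exp (-q * |ξ|)) :
    Integrable (Wtb lam b f) :=
  ((integrable_exp_neg_mul_abs hq).const_mul _).mono' (hb.aestronglyMeasurable_Wtb hfm)
    (.of_forall (hb.norm_Wtb_le_exp hlam hA hf))

theorem norm_Rop_combination_le (lam : ℝ) (y z : ℂ) :
    ‖((1 / (8 * Real.pi) : ℝ) : ℂ) * y - ((4 * lam ^ 2 : ℝ) : ℂ) * z‖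
      ≤ 1 / (8 * Real.pi) * ‖y‖ + 4 * lam ^ 2 * ‖z‖ := by
  refine (norm_sub_le _ _).trans_eq ?_
  rw [norm_mul, norm_mul, Complex.norm_real, Complex.norm_real,
    Real.norm_of_nonneg (by positivity), Real.norm_of_nonneg (by positivity)]

theorem BumpHyp.norm_Rop_sub_le (hb : BumpHyp lam b) (hlam : 0 < lam) (hA : 0 ≤ A)
    (hAlam : A ≤ lam) (hp : 0 ≤ p) (hpq : p ≤ q) (hq : 0 < q) (hκ : 0 ≤ κ) (hκ3 : κ ≤ 3)
    (hK : ∀ x : ℝ, ∫ y : ℝ, Real.exp (-p * |x - y|) * Real.exp (-q * |y|)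
      ≤ 2 * Real.pi * κ * lam * Real.exp (-p * |x|))
    (hf : ∀ ξ, |ξ| ≤ Real.sqrt 2 * lam → ‖f ξ‖ ≤ A * Real.exp (-q * |ξ|)) (ξ : ℝ) :
    ‖Rop lam b w f ξ - w ξ‖
      ≤ A ^ 2 / lam * (κ * (1 / 8 + 1 / 2 * (1 - κ / 6)⁻¹)) * Real.exp (-p * |ξ|) := by
  have hπ := Real.pi_pos
  have hK0 : 0 ≤ 2 * Real.pi * κ * lam := by positivity
  have hr : A / (2 * lam ^ 2) * (2 * Real.pi * κ * lam)
      = 2 * Real.pi * (A / lam * κ / 2) := by field_simp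
  have hAl : A / lam ≤ 1 := (div_le_one hlam).2 hAlam
  have hrκ : A / lam * κ / 2 ≤ κ / 2 := by nlinarith
  have h1 := norm_convIter_le hp hpq hq hK0 hK (hb.norm_Wtb_le_exp hlam hA hf) 1 ξ
  have h2 := norm_exp2star_le hp hpq hq hK0 hK (hb.norm_Wb_le_exp hlam hA hf) hr
    (by positivity) (by linarith) ξ
  have hinv : (1 - A / lam * κ / 2 / 3)⁻¹ ≤ (1 - κ / 6)⁻¹ :=
    inv_anti₀ (by linarith) (by linarith)
  rw [Rop, add_sub_cancel_right]
  calc _ ≤ 1 / (8 * Real.pi) * _ + 4 * lam ^ 2 * _ :=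
        (norm_Rop_combination_le _ _ _).trans (add_le_add
          (mul_le_mul_of_nonneg_left h1 (by positivity))
          (mul_le_mul_of_nonneg_left h2 (by positivity)))
    _ ≤ 1 / (8 * Real.pi) * (Real.sqrt 2 * A / (2 * lam) *
          (Real.sqrt 2 * A / (2 * lam) * (2 * Real.pi * κ * lam)) ^ 1 * Real.exp (-p * |ξ|))
        + 4 * lam ^ 2 * (A / (2 * lam ^ 2) * Real.exp (-p * |ξ|) * (A / lam * κ / 2 / 2)
          * (1 - κ / 6)⁻¹) := by gcongr
    _ = _ := by
        have h2 : Real.sqrt 2 * Real.sqrt 2 = 2 := Real.mul_self_sqrt zero_le_two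
        have : 1 / (8 * Real.pi) * (Real.sqrt 2 * A / (2 * lam) *
            (Real.sqrt 2 * A / (2 * lam) * (2 * Real.pi * κ * lam)) ^ 1 * Real.exp (-p * |ξ|))
            = (Real.sqrt 2 * Real.sqrt 2) * A ^ 2 * κ / (16 * lam) * Real.exp (-p * |ξ|) := by
          field_simp
          ring
        rw [this, h2]
        field_simp
        ring

theorem BumpHyp.norm_Rop_sub_Rop_le {D : ℝ} (hb : BumpHyp lam b) (hlam : 0 < lam) (hA : 0 ≤ A)
    (hAlam : A ≤ lam) (hp : 0 < p) (hpq : p ≤ q) (hκ : 0 ≤ κ) (hκ3 : κ ≤ 3)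
    (hK : ∀ x : ℝ, ∫ y : ℝ, Real.exp (-p * |x - y|) * Real.exp (-q * |y|)
      ≤ 2 * Real.pi * κ * lam * Real.exp (-p * |x|))
    (hpK : 2 / p ≤ 2 * Real.pi * κ * lam)
    (hfm : AEStronglyMeasurable f) (hgm : AEStronglyMeasurable g)
    (hf : ∀ ξ, |ξ| ≤ Real.sqrt 2 * lam → ‖f ξ‖ ≤ A * Real.exp (-q * |ξ|))
    (hg : ∀ ξ, |ξ| ≤ Real.sqrt 2 * lam → ‖g ξ‖ ≤ A * Real.exp (-q * |ξ|))
    (hfg : ∀ ξ, ‖f ξ - g ξ‖ ≤ D) (ξ : ℝ) :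
    ‖Rop lam b w f ξ - Rop lam b w g ξ‖ ≤ D * (κ * (1 / 4 + (1 - κ / 4)⁻¹)) := by
  have hπ := Real.pi_pos
  have hD : 0 ≤ D := (norm_nonneg _).trans (hfg 0)
  have hq : 0 < q := hp.trans_le hpq
  have hr : A / (2 * lam ^ 2) * (2 * Real.pi * κ * lam)
      = 2 * Real.pi * (A / lam * κ / 2) := by field_simp
  have hAl : A / lam ≤ 1 := (div_le_one hlam).2 hAlam
  have hrκ : A / lam * κ / 2 ≤ κ / 2 := by nlinarith
  have hWt : ∀ x, ‖Wtb lam b f x - Wtb lam b g x‖ ≤ Real.sqrt 2 / (2 * lam) * D := fun x => by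
    rw [Wtb_sub]
    exact hb.norm_Wtb_le hlam (fun _ => hD) (fun y _ => hfg y) x
  have hW : ∀ x, ‖Wb lam b f x - Wb lam b g x‖ ≤ 1 / (2 * lam ^ 2) * D := fun x => by
    rw [Wb_sub]
    exact hb.norm_Wb_le hlam (fun _ => hD) (fun y _ => hfg y) x
  have h1 := norm_convIter_sub_le hp hpq hK hpK (hb.norm_Wtb_le_exp hlam hA hf)
    (hb.norm_Wtb_le_exp hlam hA hg) (hb.integrable_Wtb hlam hA hq hfm hf)
    (hb.integrable_Wtb hlam hA hq hgm hg) hWt 1 ξ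
  have h2 := norm_exp2star_sub_le hp hpq hK hpK (hb.norm_Wb_le_exp hlam hA hf)
    (hb.norm_Wb_le_exp hlam hA hg) (hb.integrable_Wb hlam hA hq hfm hf)
    (hb.integrable_Wb hlam hA hq hgm hg) hW hr (by positivity) (by linarith) ξ
  have hinv : (1 - A / lam * κ / 2 / 2)⁻¹ ≤ (1 - κ / 4)⁻¹ :=
    inv_anti₀ (by linarith) (by linarith)
  have hinv0 : 0 ≤ (1 - A / lam * κ / 2 / 2)⁻¹ := inv_nonneg.2 (by linarith)
  have e : Rop lam b w f ξ - Rop lam b w g ξ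
      = ((1 / (8 * Real.pi) : ℝ) : ℂ) * (convIter (Wtb lam b f) 1 ξ - convIter (Wtb lam b g) 1 ξ)
        - ((4 * lam ^ 2 : ℝ) : ℂ) * (exp2star (Wb lam b f) ξ - exp2star (Wb lam b g) ξ) := by
    simp only [Rop, convIter]
    ring
  rw [e]
  calc _ ≤ 1 / (8 * Real.pi) * _ + 4 * lam ^ 2 * _ :=
        (norm_Rop_combination_le _ _ _).trans (add_le_add
          (mul_le_mul_of_nonneg_left h1 (by positivity))
          (mul_le_mul_of_nonneg_left h2 (by positivity)))
    _ ≤ 1 / (8 * Real.pi) * (((1 : ℕ) + 1) * (Real.sqrt 2 / (2 * lam) * D) *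
          (Real.sqrt 2 * A / (2 * lam) * (2 * Real.pi * κ * lam)) ^ 1)
        + 4 * lam ^ 2 * (1 / (2 * lam ^ 2) * D * (κ / 2) * (1 - κ / 4)⁻¹) := by gcongr
    _ = (Real.sqrt 2 * Real.sqrt 2) * D * κ * (A / lam) / 8 + D * κ * (1 - κ / 4)⁻¹ := by
        push_cast
        field_simp
        ring
    _ ≤ (Real.sqrt 2 * Real.sqrt 2) * D * κ * 1 / 8 + D * κ * (1 - κ / 4)⁻¹ := by gcongr
    _ = _ := by
        rw [Real.mul_self_sqrt zero_le_two]
        ring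

theorem BumpHyp.aestronglyMeasurable_Rop (hb : BumpHyp lam b) (hlam : 0 < lam) (hA : 0 ≤ A)
    (hAlam : A ≤ lam) (hp : 0 ≤ p) (hpq : p ≤ q) (hq : 0 < q) (hκ : 0 ≤ κ) (hκ3 : κ ≤ 3)
    (hK : ∀ x : ℝ, ∫ y : ℝ, Real.exp (-p * |x - y|) * Real.exp (-q * |y|)
      ≤ 2 * Real.pi * κ * lam * Real.exp (-p * |x|))
    (hw : AEStronglyMeasurable w) (hfm : AEStronglyMeasurable f)
    (hf : ∀ ξ, |ξ| ≤ Real.sqrt 2 * lam → ‖f ξ‖ ≤ A * Real.exp (-q * |ξ|)) :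
    AEStronglyMeasurable (Rop lam b w f) := by
  have hπ := Real.pi_pos
  have hr : A / (2 * lam ^ 2) * (2 * Real.pi * κ * lam)
      = 2 * Real.pi * (A / lam * κ / 2) := by field_simp
  have hAl : A / lam ≤ 1 := (div_le_one hlam).2 hAlam
  have hrκ : A / lam * κ / 2 ≤ κ / 2 := by nlinarith
  have hWt := hb.integrable_Wtb hlam hA hq hfm hf
  exact (((integrable_conv hWt hWt).aestronglyMeasurable.const_mul _).sub
    ((aestronglyMeasurable_exp2star hp hpq hq (by positivity) hK
      (hb.norm_Wb_le_exp hlam hA hf) hr (by positivity) (by linarith)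
      (hb.integrable_Wb hlam hA hq hfm hf)).const_mul _)).add hw

end Rop

theorem exp_sqrt_two_div_two_le : Real.exp (Real.sqrt 2 / 2) ≤ 2.03 := by
  have hs : Real.sqrt 2 ≤ 1.415 := Real.sqrt_le_iff.2 ⟨by norm_num, by norm_num⟩
  have h0 : 0 ≤ Real.sqrt 2 := Real.sqrt_nonneg 2
  have h := Real.exp_bound' (x := 1.415 / 2) (by norm_num) (by norm_num) (n := 5) (by norm_num)
  refine (Real.exp_le_exp.2 (by linarith)).trans (h.trans ?_)
  norm_num [Finset.sum_range_succ, Nat.factorial]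

/-- Theorem `spectrum:theorem2`: existence of a solution of the
fixed point equation `ψ = R[ψ]` with exponentially decaying pointwise bounds. -/
theorem stmt_8
    (lam μ Γ : ℝ) (hlam : 0 < lam) (hμ : 0 < μ) (hΓ : 0 < Γ)
    (hlam2 : lam > 2 * max Γ (1 / μ))
    (b : ℝ → ℝ) (hb : BumpHyp lam b)
    (w : ℝ → ℂ) (hw : Integrable w)
    (hwbd : ∀ ξ : ℝ, ‖w ξ‖ ≤ Γ * Real.exp (-μ * |ξ|)) :
    ∃ ψ : ℝ → ℂ, Integrable ψ ∧
      (∀ ξ : ℝ, ψ ξ = Rop lam b w ψ ξ) ∧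
      (∀ ξ : ℝ, |ξ| ≤ Real.sqrt 2 * lam →
        ‖ψ ξ‖ ≤ (1 + 2 * Γ / lam) * Γ * Real.exp (-μ * |ξ|)) ∧
      (∀ ξ : ℝ, ‖ψ ξ‖ ≤
        (1 + 4 * Γ / lam) * Γ * Real.exp (-(μ - 1 / (2 * Real.pi * lam)) * |ξ|)) := by
  have hπ := Real.pi_pos
  have hπ314 : 3.14 < Real.pi := by linarith [Real.pi_gt_d2]
  have hΓlam : Γ / lam ≤ 1 / 2 := by
    rw [div_le_iff₀ hlam]
    linarith [le_max_left Γ (1 / μ)]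
  have hμlam : 2 / lam ≤ μ := by
    have h : 2 * (1 / μ) ≤ lam := by linarith [le_max_right Γ (1 / μ)]
    rw [mul_one_div, div_le_iff₀ hμ] at h
    rw [div_le_iff₀ hlam]
    linarith
  have hinv : 0 < 1 / lam := by positivity
  have hμ2 : 2 * (1 / lam) ≤ μ := by rwa [mul_one_div]
  set A := (1 + 2 * Γ / lam) * Γ with hAdef
  have hA : 0 ≤ A := by positivity
  have htwo : 1 + 2 * Γ / lam ≤ 2 := by rw [mul_div_assoc]; linarith
  have hA2 : A ≤ 2 * Γ := mul_le_mul_of_nonneg_right htwo hΓ.le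
  have hAlam : A ≤ lam := by
    rw [div_le_iff₀ hlam] at hΓlam
    linarith
  have hAsq : A ^ 2 / lam ≤ 4 * (Γ / lam) * Γ := by
    rw [div_le_iff₀ hlam]
    field_simp
    nlinarith
  -- The loss `1/(2λ)` in the exponent gives the estimates for `|ξ| ≤ √2 λ`.
  obtain ⟨p, hpdef⟩ : ∃ p, p = μ - 1 / (2 * lam) := ⟨_, rfl⟩
  have hc : 1 / (2 * lam) = 1 / lam / 2 := by ring
  have hpge : 3 / 2 * (1 / lam) ≤ p := by rw [hpdef, hc]; linarith
  have hp : 0 < p := by linarith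
  have hpμ : p ≤ μ := by rw [hpdef, hc]; linarith
  have hK : ∀ x : ℝ, ∫ y : ℝ, Real.exp (-p * |x - y|) * Real.exp (-μ * |y|)
      ≤ 2 * Real.pi * 0.364 * lam * Real.exp (-p * |x|) := by
    intro x
    rw [hpdef]
    refine (integral_exp_mul_exp_abs_le (c := 1 / (2 * lam)) (by positivity)
      (by rw [hc]; linarith) x).trans ?_
    gcongr
    have : 1 / (2 * μ - 1 / (2 * lam)) ≤ 1 / (7 / 2 * (1 / lam)) :=
      one_div_le_one_div_of_le (by positivity) (by rw [hc]; linarith)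
    have e : 1 / (7 / 2 * (1 / lam)) = 2 / 7 * lam := by field_simp
    rw [one_div_one_div]
    nlinarith
  have hpK : 2 / p ≤ 2 * Real.pi * 0.364 * lam := by
    have : 2 / p ≤ 2 / (3 / 2 * (1 / lam)) := by gcongr
    have e : 2 / (3 / 2 * (1 / lam)) = 4 / 3 * lam := by field_simp; norm_num
    nlinarith
  have hκ : (0.364 : ℝ) * (1 / 8 + 1 / 2 * (1 - 0.364 / 6)⁻¹) * 2.03 ≤ 1 / 2 := by norm_num
  have hκ0 : (0 : ℝ) ≤ 0.364 * (1 / 8 + 1 / 2 * (1 - 0.364 / 6)⁻¹) := by norm_num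
  have hκ' : (0.364 : ℝ) * (1 / 4 + (1 - 0.364 / 4)⁻¹) ≤ 1 / 2 := by norm_num
  have hRsub : ∀ f : ℝ → ℂ,
      (∀ ξ, |ξ| ≤ Real.sqrt 2 * lam → ‖f ξ‖ ≤ A * Real.exp (-μ * |ξ|)) →
      ∀ ξ, ‖Rop lam b w f ξ - w ξ‖ ≤ _ :=
    fun f hf => hb.norm_Rop_sub_le hlam hA hAlam hp.le hpμ hμ (by norm_num) (by norm_num) hK hf
  have hnorm : ∀ (f : ℝ → ℂ) (ξ : ℝ),
      ‖Rop lam b w f ξ‖ ≤ ‖w ξ‖ + ‖Rop lam b w f ξ - w ξ‖ := fun f ξ => by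
    simpa using norm_add_le (w ξ) (Rop lam b w f ξ - w ξ)
  obtain ⟨ψ, ⟨hψm, hψ⟩, hψR⟩ := exists_eq_of_half_contraction (Rop lam b w)
    (fun f => AEStronglyMeasurable f ∧
      ∀ ξ, |ξ| ≤ Real.sqrt 2 * lam → ‖f ξ‖ ≤ A * Real.exp (-μ * |ξ|))
    (fun f hf => ⟨hb.aestronglyMeasurable_Rop hlam hA hAlam hp.le hpμ hμ (by norm_num)
      (by norm_num) hK hw.aestronglyMeasurable hf.1 hf.2, fun ξ hξ => by
        have hexp : Real.exp (-p * |ξ|) ≤ 2.03 * Real.exp (-μ * |ξ|) := by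
          have : -p * |ξ| = |ξ| / (2 * lam) + -μ * |ξ| := by rw [hpdef]; ring
          rw [this, Real.exp_add]
          gcongr
          refine le_trans (Real.exp_le_exp.2 ?_) exp_sqrt_two_div_two_le
          rw [div_le_div_iff₀ (by positivity) two_pos]
          linarith
        calc _ ≤ _ := hnorm f ξ
          _ ≤ Γ * Real.exp (-μ * |ξ|) + 4 * (Γ / lam) * Γ *
              (0.364 * (1 / 8 + 1 / 2 * (1 - 0.364 / 6)⁻¹)) *
              (2.03 * Real.exp (-μ * |ξ|)) := by
              refine add_le_add (hwbd ξ) ((hRsub f hf.2 ξ).trans ?_)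
              gcongr
          _ = (1 + 4 * (Γ / lam) * (0.364 * (1 / 8 + 1 / 2 * (1 - 0.364 / 6)⁻¹) * 2.03)) * Γ
              * Real.exp (-μ * |ξ|) := by ring
          _ ≤ (1 + 4 * (Γ / lam) * (1 / 2)) * Γ * Real.exp (-μ * |ξ|) := by gcongr
          _ = _ := by rw [hAdef]; ring⟩)
    (fun F f hF hlim => ⟨aestronglyMeasurable_of_tendsto_ae atTop (fun n => (hF n).1)
      (.of_forall hlim), fun ξ hξ => le_of_tendsto (hlim ξ).norm
        (.of_forall fun n => (hF n).2 ξ hξ)⟩)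
    (fun f g D hf hg hfg ξ => by
      have hD : 0 ≤ D := (norm_nonneg _).trans (hfg 0)
      refine (hb.norm_Rop_sub_Rop_le hlam hA hAlam hp hpμ (by norm_num) (by norm_num) hK hpK
        hf.1 hg.1 hf.2 hg.2 hfg ξ).trans ?_
      rw [div_eq_mul_one_div D]
      gcongr)
    (f₀ := 0) ⟨aestronglyMeasurable_zero, fun ξ _ => by simp; positivity⟩
    (D := Γ + A ^ 2 / lam * (0.364 * (1 / 8 + 1 / 2 * (1 - 0.364 / 6)⁻¹)))
    (fun ξ => by
      rw [Pi.zero_apply, zero_sub, norm_neg]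
      have hle : ∀ {C r : ℝ}, 0 ≤ C → 0 ≤ r → C * Real.exp (-r * |ξ|) ≤ C :=
        fun hC hr => mul_le_of_le_one_right hC (Real.exp_le_one_iff.2
          (by nlinarith [mul_nonneg hr (abs_nonneg ξ)]))
      exact (hnorm 0 ξ).trans (add_le_add ((hwbd ξ).trans (hle hΓ.le hμ.le))
        ((hRsub 0 (fun ξ _ => by simp; positivity) ξ).trans (hle (by positivity) hp.le))))
  -- The loss `1/(2πλ)` gives the global estimate.
  obtain ⟨s, hsdef⟩ : ∃ s, s = μ - 1 / (2 * Real.pi * lam) := ⟨_, rfl⟩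
  have hcs : 1 / (2 * Real.pi * lam) ≤ 1 / 5 * (1 / lam) := by
    rw [one_div_mul_one_div]
    gcongr
    linarith
  have hcs0 : 0 < 1 / (2 * Real.pi * lam) := by positivity
  have hs : 0 < s := by rw [hsdef]; linarith
  have hsμ : s ≤ μ := by rw [hsdef]; linarith
  have hKs : ∀ x : ℝ, ∫ y : ℝ, Real.exp (-s * |x - y|) * Real.exp (-μ * |y|)
      ≤ 2 * Real.pi * 1.05 * lam * Real.exp (-s * |x|) := by
    intro x
    rw [hsdef]
    refine (integral_exp_mul_exp_abs_le (c := 1 / (2 * Real.pi * lam)) hcs0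
      (by linarith) x).trans ?_
    gcongr
    have : 1 / (2 * μ - 1 / (2 * Real.pi * lam)) ≤ 1 / (19 / 5 * (1 / lam)) :=
      one_div_le_one_div_of_le (by positivity) (by linarith)
    have e : 1 / (19 / 5 * (1 / lam)) = 5 / 19 * lam := by field_simp
    rw [one_div_one_div]
    nlinarith
  have hglob : ∀ ξ, ‖ψ ξ‖ ≤ (1 + 4 * Γ / lam) * Γ * Real.exp (-s * |ξ|) := fun ξ => by
    have hκs : (1.05 : ℝ) * (1 / 8 + 1 / 2 * (1 - 1.05 / 6)⁻¹) ≤ 1 := by norm_num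
    rw [hψR ξ]
    calc _ ≤ _ := hnorm ψ ξ
      _ ≤ Γ * Real.exp (-s * |ξ|) + 4 * (Γ / lam) * Γ * 1 * Real.exp (-s * |ξ|) := by
          refine add_le_add ((hwbd ξ).trans (by gcongr))
            ((hb.norm_Rop_sub_le hlam hA hAlam hs.le hsμ hμ (by norm_num) (by norm_num) hKs hψ
              ξ).trans ?_)
          gcongr
      _ = _ := by ring
  refine ⟨ψ, ((integrable_exp_neg_mul_abs hs).const_mul _).mono' hψm (.of_forall hglob), hψR,
    hψ, ?_⟩
  rw [← hsdef]
  exact hglob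

end
end

section
/- For every integer m ≥ 1 and every real number t > 0, K_{m−1/2}(t) ≤ (√π/2)·(t/2)^{1/2−m}·exp(−t)·Γ((1+t)/2 + m − 1)/Γ((1+t)/2), where K_ν denotes the modified Bessel function of the second kind. -/
open MeasureTheory Filter

noncomputable section

theorem tendsto_exp_mul_mul_exp_neg_mul_cosh (a : ℝ) {t : ℝ} (ht : 0 < t) :
    Tendsto (fun s : ℝ => Real.exp (a * s) * Real.exp (-t * Real.cosh s)) atTop (nhds 0) := by
  have h := (tendsto_rpow_mul_exp_neg_mul_atTop_nhds_zero a (t / 2) (by positivity)).comp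
    Real.tendsto_exp_atTop
  refine squeeze_zero (fun s => by positivity) (fun s => ?_) h
  have h1 : Real.exp s ≤ 2 * Real.cosh s := by
    rw [Real.cosh_eq]
    linarith [Real.exp_pos (-s)]
  simp only [Function.comp_apply]
  rw [← Real.exp_mul, mul_comm s a]
  gcongr ?_ * Real.exp ?_
  nlinarith

theorem cosh_mul_le_exp_abs_mul (ν : ℝ) {s : ℝ} (hs : 0 ≤ s) :
    Real.cosh (ν * s) ≤ Real.exp (|ν| * s) := by
  rw [← Real.cosh_abs, abs_mul, abs_of_nonneg hs, ← Real.cosh_add_sinh]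
  linarith [Real.sinh_nonneg_iff.2 (by positivity : 0 ≤ |ν| * s)]

theorem integrableOn_besselK (ν : ℝ) {t : ℝ} (ht : 0 < t) :
    IntegrableOn (fun s => Real.exp (-t * Real.cosh s) * Real.cosh (ν * s)) (Set.Ioi 0) := by
  refine integrable_of_isBigO_exp_neg one_pos (by fun_prop) ?_
  refine Asymptotics.IsBigO.of_bound 1 ?_
  have h := tendsto_exp_mul_mul_exp_neg_mul_cosh (|ν| + 1) ht
  filter_upwards [h.eventually_le_const one_pos, eventually_ge_atTop 0] with s h1 hs
  rw [Real.norm_of_nonneg (mul_nonneg (Real.exp_pos _).le (Real.cosh_pos _).le),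
    Real.norm_of_nonneg (Real.exp_pos _).le]
  calc Real.exp (-t * Real.cosh s) * Real.cosh (ν * s)
      ≤ Real.exp (-t * Real.cosh s) * Real.exp (|ν| * s) := by
        gcongr
        exact cosh_mul_le_exp_abs_mul ν hs
    _ = Real.exp ((|ν| + 1) * s) * Real.exp (-t * Real.cosh s) * Real.exp (-1 * s) := by
        simp only [← Real.exp_add]
        ring_nf
    _ ≤ 1 * Real.exp (-1 * s) := by gcongr

theorem besselK_add_one_sub_besselK_sub_one (ν : ℝ) {t : ℝ} (ht : 0 < t) :
    besselK (ν + 1) t - besselK (ν - 1) t = 2 * ν / t * besselK ν t := by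
  have hA := integrableOn_besselK (ν + 1) ht
  have hB := integrableOn_besselK (ν - 1) ht
  have hC := integrableOn_besselK ν ht
  have hdiff : IntegrableOn
      (fun s => Real.exp (-t * Real.cosh s) * Real.cosh ((ν + 1) * s)
        - Real.exp (-t * Real.cosh s) * Real.cosh ((ν - 1) * s)) (Set.Ioi 0) := hA.sub hB
  have hint := (hC.const_mul ν).sub (hdiff.const_mul (t / 2))
  have hderiv : ∀ s ∈ Set.Ici (0 : ℝ),
      HasDerivAt (fun s => Real.exp (-t * Real.cosh s) * Real.sinh (ν * s))
      (ν * (Real.exp (-t * Real.cosh s) * Real.cosh (ν * s))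
        - t / 2 * (Real.exp (-t * Real.cosh s) * Real.cosh ((ν + 1) * s)
          - Real.exp (-t * Real.cosh s) * Real.cosh ((ν - 1) * s))) s := by
    intro s _
    have h1 := ((Real.hasDerivAt_cosh s).const_mul (-t)).exp
    have h2 := ((hasDerivAt_id s).const_mul ν).sinh
    refine (h1.mul h2).congr_deriv ?_
    simp only [id_eq, add_mul, sub_mul, one_mul, Real.cosh_add, Real.cosh_sub]
    ring
  have hlim : Tendsto (fun s => Real.exp (-t * Real.cosh s) * Real.sinh (ν * s)) atTop
      (nhds 0) := by
    refine squeeze_zero_norm' ?_ (tendsto_exp_mul_mul_exp_neg_mul_cosh |ν| ht)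
    filter_upwards [eventually_ge_atTop 0] with s hs
    rw [norm_mul, Real.norm_of_nonneg (Real.exp_pos _).le, mul_comm]
    gcongr
    refine le_trans ?_ (cosh_mul_le_exp_abs_mul ν hs)
    rw [Real.norm_eq_abs]
    exact abs_le_of_sq_le_sq (by linarith [Real.cosh_sq (ν * s)]) (Real.cosh_pos _).le
  have h := integral_Ioi_of_hasDerivAt_of_tendsto' hderiv hint hlim
  rw [integral_sub (hC.const_mul ν) (hdiff.const_mul (t / 2)), integral_const_mul,
    integral_const_mul, integral_sub hA hB] at h
  simp only [mul_zero, Real.sinh_zero, sub_zero] at h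
  change ν * besselK ν t - t / 2 * (besselK (ν + 1) t - besselK (ν - 1) t) = 0 at h
  field_simp
  linarith

theorem besselK_nonneg (ν t : ℝ) : 0 ≤ besselK ν t :=
  integral_nonneg fun _ => mul_nonneg (Real.exp_pos _).le (Real.cosh_pos _).le

theorem besselK_le_besselK_of_abs_le {μ ν t : ℝ} (ht : 0 < t) (h : |μ| ≤ |ν|) :
    besselK μ t ≤ besselK ν t := by
  refine integral_mono (integrableOn_besselK μ ht) (integrableOn_besselK ν ht) fun s => ?_
  have : Real.cosh (μ * s) ≤ Real.cosh (ν * s) := by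
    rw [Real.cosh_le_cosh, abs_mul, abs_mul]
    gcongr
  dsimp only
  gcongr

theorem besselK_add_one_le {ν t : ℝ} (hν : 1 / 2 ≤ ν) (ht : 0 < t) :
    besselK (ν + 1) t ≤ (2 * ν / t + 1) * besselK ν t := by
  have h1 := besselK_add_one_sub_besselK_sub_one ν ht
  have h2 : besselK (ν - 1) t ≤ besselK ν t := by
    refine besselK_le_besselK_of_abs_le ht ?_
    rw [abs_of_nonneg (by linarith : 0 ≤ ν), abs_le]
    constructor <;> linarith
  linarith

theorem besselK_one_half {t : ℝ} (ht : 0 < t) :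
    besselK (1 / 2) t = √(Real.pi / (2 * t)) * Real.exp (-t) := by
  have hcosh (s : ℝ) : Real.cosh s = 1 + 2 * Real.sinh (s / 2) ^ 2 := by
    have h := Real.cosh_two_mul (s / 2)
    rw [mul_div_cancel₀ s two_ne_zero, Real.cosh_sq] at h
    linarith
  have hpt (s : ℝ) : Real.exp (-t * Real.cosh s) * Real.cosh (1 / 2 * s) =
      2 * Real.exp (-t) * (((fun u => Real.exp (-(2 * t) * u ^ 2)) ∘ fun s => Real.sinh (s / 2)) s
        * (Real.cosh (s / 2) * (1 / 2))) := by
    have : Real.exp (-t * Real.cosh s) =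
        Real.exp (-t) * Real.exp (-(2 * t) * Real.sinh (s / 2) ^ 2) := by
      rw [← Real.exp_add, hcosh]
      ring_nf
    rw [this, one_div_mul_eq_div]
    simp only [Function.comp_apply]
    ring
  have hsub := integral_comp_mul_deriv_Ioi (a := 0) (f := fun s => Real.sinh (s / 2))
    (f' := fun s => Real.cosh (s / 2) * (1 / 2)) (g := fun u => Real.exp (-(2 * t) * u ^ 2))
    (by fun_prop)
    (Real.sinhOrderIso.tendsto_atTop.comp (tendsto_id.atTop_div_const two_pos))
    (fun s _ => ((hasDerivAt_id s).div_const 2).sinh.hasDerivWithinAt)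
    (by fun_prop)
    (integrable_exp_neg_mul_sq (by positivity)).integrableOn
    (by
      rw [integrableOn_Ici_iff_integrableOn_Ioi]
      have h := (integrableOn_besselK (1 / 2) ht).const_mul (2 * Real.exp (-t))⁻¹
      refine IntegrableOn.congr_fun h (fun s _ => ?_) measurableSet_Ioi
      rw [hpt, inv_mul_cancel_left₀ (by positivity)])
  unfold besselK
  simp_rw [hpt]
  rw [integral_const_mul, hsub, zero_div, Real.sinh_zero, integral_gaussian_Ioi]
  ring

/-- Formula `spectrum:S2:kbound`: bound on half-integer order
modified Bessel functions of the second kind. -/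
theorem stmt_17 :
    ∀ m : ℕ, 1 ≤ m → ∀ t : ℝ, 0 < t →
      besselK ((m : ℝ) - 1 / 2) t ≤
        (Real.sqrt Real.pi / 2) * (t / 2) ^ ((1 : ℝ) / 2 - (m : ℝ)) * Real.exp (-t)
          * Real.Gamma ((1 + t) / 2 + (m : ℝ) - 1) / Real.Gamma ((1 + t) / 2) := by
  intro m hm t ht
  induction m, hm using Nat.le_induction with
  | base =>
    have hΓ : Real.Gamma ((1 + t) / 2) ≠ 0 := (Real.Gamma_pos_of_pos (by positivity)).ne'
    have hK : √(Real.pi / (2 * t)) = √Real.pi / 2 * (t / 2) ^ (-(1 / 2) : ℝ) := by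
      rw [Real.rpow_neg (by positivity), ← Real.sqrt_eq_rpow,
        show Real.pi / (2 * t) = Real.pi / 2 ^ 2 / (t / 2) by field_simp,
        Real.sqrt_div (by positivity), Real.sqrt_div Real.pi_pos.le,
        Real.sqrt_sq zero_le_two, div_eq_mul_inv (√Real.pi / 2)]
    norm_num only [Nat.cast_one, add_sub_cancel_right]
    rw [mul_div_cancel_right₀ _ hΓ, besselK_one_half ht, hK]
  | succ m hm ih =>
    have hm' : (1 : ℝ) ≤ m := by exact_mod_cast hm
    have hx : 0 < (1 + t) / 2 + (m : ℝ) - 1 := by linarith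
    have hΓ : Real.Gamma ((1 + t) / 2 + ((m + 1 : ℕ) : ℝ) - 1) =
        ((1 + t) / 2 + (m : ℝ) - 1) * Real.Gamma ((1 + t) / 2 + (m : ℝ) - 1) := by
      rw [← Real.Gamma_add_one hx.ne']
      push_cast
      ring_nf
    have hpow : (t / 2) ^ ((1 : ℝ) / 2 - ((m + 1 : ℕ) : ℝ)) =
        (t / 2) ^ ((1 : ℝ) / 2 - (m : ℝ)) / (t / 2) := by
      rw [← Real.rpow_sub_one (by positivity)]
      push_cast
      ring_nf
    have hstep := besselK_add_one_le (ν := (m : ℝ) - 1 / 2) (by linarith) ht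
    rw [show ((m + 1 : ℕ) : ℝ) - 1 / 2 = (m : ℝ) - 1 / 2 + 1 by push_cast; ring, hΓ, hpow]
    have hc : 0 ≤ 2 * ((m : ℝ) - 1 / 2) / t + 1 := by
      have : 0 ≤ (m : ℝ) - 1 / 2 := by linarith
      positivity
    refine (hstep.trans (mul_le_mul_of_nonneg_left ih hc)).trans_eq ?_
    field_simp
    ring

end
end

section
/- Suppose C > 0 and μ > 0 are real numbers, and define g₁(ξ) = C·exp(−μ|ξ|) and g_{m+1}(ξ) = (1/2π)·(g_m * g₁)(ξ) for each integer m ≥ 1. Then for every integer m ≥ 1 and every ξ ∈ ℝ, g_m(ξ) ≤ C·exp(−μ|ξ|)·(C/(πμ))^{m−1}·Γ((1 + μ|ξ|)/2 + m − 1)/(Γ(m)·Γ((1 + μ|ξ|)/2)). -/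
open MeasureTheory Filter

noncomputable section

open Polynomial in
/-- The reverse Bessel polynomials. -/
def reverseBessel : ℕ → ℝ[X]
  | 0 => 1
  | 1 => X + 1
  | n + 2 => (2 * (n : ℝ[X]) + 3) * reverseBessel (n + 1) + X ^ 2 * reverseBessel n

open Polynomial in
theorem derivative_reverseBessel_succ (n : ℕ) :
    derivative (reverseBessel (n + 1)) = reverseBessel (n + 1) - X * reverseBessel n := by
  induction n using Nat.twoStepInduction with
  | zero => simp [reverseBessel]
  | one => simp [reverseBessel]; ring
  | more n ih₀ ih₁ =>
    rw [reverseBessel]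
    have h : derivative (2 * ((n + 1 : ℕ) : ℝ[X]) + 3) = 0 := by simp
    rw [derivative_add, derivative_mul, derivative_mul, h, ih₀, ih₁]
    simp only [reverseBessel, derivative_X_pow]
    push_cast
    simp only [map_ofNat]
    ring

theorem reverseBessel_eval_add_two (n : ℕ) (t : ℝ) :
    (reverseBessel (n + 2)).eval t =
      (2 * n + 3) * (reverseBessel (n + 1)).eval t + t ^ 2 * (reverseBessel n).eval t := by
  simp [reverseBessel]

theorem reverseBessel_eval_pos (n : ℕ) {t : ℝ} (ht : 0 ≤ t) : 0 < (reverseBessel n).eval t := by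
  induction n using Nat.twoStepInduction with
  | zero => simp [reverseBessel]
  | one => simp [reverseBessel]; positivity
  | more n ih₀ ih₁ => rw [reverseBessel_eval_add_two]; positivity

theorem mul_reverseBessel_eval_le (n : ℕ) {t : ℝ} (ht : 0 ≤ t) :
    t * (reverseBessel n).eval t ≤ (reverseBessel (n + 1)).eval t := by
  induction n using Nat.twoStepInduction with
  | zero => simp [reverseBessel]
  | one => simp [reverseBessel]; nlinarith
  | more n ih₀ ih₁ =>
    have h₁ := reverseBessel_eval_pos (n + 2) ht
    rw [reverseBessel_eval_add_two (n + 1)]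
    nth_rewrite 1 [reverseBessel_eval_add_two n]
    push_cast
    nlinarith [mul_le_mul_of_nonneg_left ih₀ ht]

theorem reverseBessel_eval_succ_le (n : ℕ) {t : ℝ} (ht : 0 ≤ t) :
    (reverseBessel (n + 1)).eval t ≤ (2 * n + 1 + t) * (reverseBessel n).eval t := by
  cases n with
  | zero => simp [reverseBessel]; linarith
  | succ n =>
    rw [reverseBessel_eval_add_two]
    push_cast
    nlinarith [mul_le_mul_of_nonneg_left (mul_reverseBessel_eval_le n ht) ht]

theorem reverseBessel_eval_le_Gamma (n : ℕ) {t : ℝ} (ht : 0 ≤ t) :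
    (reverseBessel n).eval t ≤
      2 ^ n * (Real.Gamma ((1 + t) / 2 + n) / Real.Gamma ((1 + t) / 2)) := by
  have hpos : 0 < Real.Gamma ((1 + t) / 2) := Real.Gamma_pos_of_pos (by positivity)
  induction n with
  | zero => simp [reverseBessel, hpos.ne']
  | succ n ih =>
    have h := Real.Gamma_add_one (s := (1 + t) / 2 + n) (by positivity)
    push_cast
    rw [← add_assoc, h]
    calc _ ≤ _ := reverseBessel_eval_succ_le n ht
      _ ≤ _ := mul_le_mul_of_nonneg_left ih (by positivity)
      _ = _ := by ring

theorem hasDerivAt_reverseBessel_add (n : ℕ) (s : ℝ) :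
    HasDerivAt (fun s ↦ ((reverseBessel (n + 1)).eval s + s * (reverseBessel n).eval s)
      / (2 * (n + 1))) ((reverseBessel n).eval s) s := by
  have h₁ := (reverseBessel (n + 1)).hasDerivAt s
  have h₂ := (reverseBessel n).hasDerivAt s
  have hn : (2 * ((n : ℝ) + 1)) ≠ 0 := by positivity
  refine ((h₁.add ((hasDerivAt_id s).mul h₂)).div_const (2 * ((n : ℝ) + 1))).congr_deriv ?_
  rw [div_eq_iff hn, derivative_reverseBessel_succ]
  cases n with
  | zero => simp [reverseBessel]; ring
  | succ n =>
    rw [derivative_reverseBessel_succ]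
    simp [reverseBessel]
    ring

theorem hasDerivAt_reverseBessel_sub_mul_exp (n : ℕ) (s : ℝ) :
    HasDerivAt (fun s ↦ -((reverseBessel (n + 1)).eval s - s * (reverseBessel n).eval s)
      / (2 * (n + 1)) * Real.exp (-2 * s)) ((reverseBessel n).eval s * Real.exp (-2 * s)) s := by
  have h₁ := (reverseBessel (n + 1)).hasDerivAt s
  rw [derivative_reverseBessel_succ] at h₁
  have hn : (2 * ((n : ℝ) + 1)) ≠ 0 := by positivity
  have h₃ := ((hasDerivAt_id s).const_mul (-2 : ℝ)).exp
  have h₂ := (hasDerivAt_reverseBessel_add n s).sub (h₁.div_const ((n : ℝ) + 1))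
  refine ((h₂.mul h₃).congr_deriv ?_).congr_of_eventuallyEq (.of_forall fun x ↦ ?_)
  · simp
    field_simp
    ring
  · simp
    field_simp
    ring

theorem tendsto_reverseBessel_sub_mul_exp (n : ℕ) :
    Tendsto (fun s ↦ -((reverseBessel (n + 1)).eval s - s * (reverseBessel n).eval s)
      / (2 * (n + 1)) * Real.exp (-2 * s)) atTop (nhds 0) := by
  have h₁ := ((reverseBessel (n + 1) - Polynomial.X * reverseBessel n).tendsto_div_exp_atTop).mul
    Real.tendsto_exp_neg_atTop_nhds_zero
  have h₂ := h₁.div_const (-(2 * ((n : ℝ) + 1)))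
  simp only [mul_zero, zero_div] at h₂
  refine h₂.congr fun s ↦ ?_
  have h : Real.exp (-2 * s) = Real.exp (-s) * Real.exp (-s) := by
    rw [← Real.exp_add]; ring_nf
  simp only [Polynomial.eval_sub, Polynomial.eval_mul, Polynomial.eval_X]
  rw [h, div_eq_mul_inv _ (Real.exp s), ← Real.exp_neg]
  field_simp

theorem integrableOn_reverseBessel_mul_exp (n : ℕ) {a : ℝ} (ha : 0 ≤ a) :
    IntegrableOn (fun s ↦ (reverseBessel n).eval s * Real.exp (-2 * s)) (Set.Ioi a) :=
  integrableOn_Ioi_deriv_of_nonneg' (fun s _ ↦ hasDerivAt_reverseBessel_sub_mul_exp n s)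
    (fun _ hs ↦ mul_nonneg (reverseBessel_eval_pos n (ha.trans (le_of_lt hs))).le
      (Real.exp_pos _).le) (tendsto_reverseBessel_sub_mul_exp n)

theorem integral_Ioi_reverseBessel_mul_exp (n : ℕ) {a : ℝ} (ha : 0 ≤ a) :
    ∫ s in Set.Ioi a, (reverseBessel n).eval s * Real.exp (-2 * s) =
      ((reverseBessel (n + 1)).eval a - a * (reverseBessel n).eval a)
        / (2 * (n + 1)) * Real.exp (-2 * a) := by
  rw [integral_Ioi_of_hasDerivAt_of_nonneg'
    (fun s _ ↦ hasDerivAt_reverseBessel_sub_mul_exp n s)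
    (fun _ hs ↦ mul_nonneg (reverseBessel_eval_pos n (ha.trans (le_of_lt hs))).le
      (Real.exp_pos _).le) (tendsto_reverseBessel_sub_mul_exp n)]
  ring

/-- The functions `θₙ(|x|) exp(-|x|)`, with `θₙ` the reverse Bessel polynomials. -/
def besselDensity (n : ℕ) (x : ℝ) : ℝ := (reverseBessel n).eval |x| * Real.exp (-|x|)

theorem besselDensity_neg (n : ℕ) (x : ℝ) : besselDensity n (-x) = besselDensity n x := by
  simp [besselDensity]

theorem integral_besselDensity_mul_exp_of_nonneg (n : ℕ) {x : ℝ} (hx : 0 ≤ x) :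
    ∫ y, besselDensity n y * Real.exp (-|x - y|) = besselDensity (n + 1) x / (n + 1) := by
  set φ : ℝ → ℝ := fun y ↦ besselDensity n y * Real.exp (-|x - y|) with hφ
  have hcont : Continuous φ := by
    simp only [hφ, besselDensity]
    fun_prop
  have hneg : Set.EqOn (fun y ↦ Real.exp (-x) *
      ((reverseBessel n).eval y * Real.exp (-2 * y))) (fun y ↦ φ (-y)) (Set.Ioi 0) := by
    intro y hy
    have hy' : 0 < y := hy
    have h : Real.exp (-2 * y) = Real.exp (-y) * Real.exp (-y) := by
      rw [← Real.exp_add]; ring_nf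
    have h' : Real.exp (-(x + y)) = Real.exp (-x) * Real.exp (-y) := by
      rw [← Real.exp_add]; ring_nf
    simp only [hφ, besselDensity, abs_neg, sub_neg_eq_add, abs_of_pos hy',
      abs_of_nonneg (add_nonneg hx hy'.le), h, h']
    ring
  have hmid : Set.EqOn φ (fun y ↦ Real.exp (-x) * (reverseBessel n).eval y)
      (Set.uIcc 0 x) := by
    intro y hy
    rw [Set.uIcc_of_le hx] at hy
    have h : Real.exp (-x) = Real.exp (-y) * Real.exp (-(x - y)) := by
      rw [← Real.exp_add]; ring_nf
    simp only [hφ, besselDensity, abs_of_nonneg hy.1, abs_of_nonneg (sub_nonneg.2 hy.2), h]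
    ring
  have hpos : Set.EqOn (fun y ↦ Real.exp x *
      ((reverseBessel n).eval y * Real.exp (-2 * y))) φ (Set.Ioi x) := by
    intro y hy
    have hy' : x < y := hy
    have h : Real.exp (-2 * y) = Real.exp (-y) * Real.exp (-y) := by
      rw [← Real.exp_add]; ring_nf
    have h' : Real.exp (-(y - x)) = Real.exp x * Real.exp (-y) := by
      rw [← Real.exp_add]; ring_nf
    simp only [hφ, besselDensity, abs_of_pos (hx.trans_lt hy'), abs_sub_comm x y,
      abs_of_pos (sub_pos.2 hy'), h, h']
    ring
  have ineg : IntegrableOn (fun y ↦ φ (-y)) (Set.Ioi 0) :=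
    IntegrableOn.congr_fun ((integrableOn_reverseBessel_mul_exp n le_rfl).const_mul _) hneg measurableSet_Ioi
  have ileft : IntegrableOn φ (Set.Iic 0) := by
    rw [integrableOn_Iic_iff_integrableOn_Iio]
    have h := (Measure.measurePreserving_neg (volume : Measure ℝ)).integrableOn_comp_preimage
      (MeasurableEquiv.neg ℝ).measurableEmbedding (f := φ) (s := Set.Iio 0)
    refine h.1 ?_
    simpa [Function.comp_def] using ineg
  have iright : IntegrableOn φ (Set.Ioi x) :=
    IntegrableOn.congr_fun ((integrableOn_reverseBessel_mul_exp n hx).const_mul _) hpos measurableSet_Ioi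
  have imid : IntervalIntegrable φ volume 0 x := hcont.intervalIntegrable _ _
  have ipos : IntegrableOn φ (Set.Ioi 0) := by
    rw [← Set.Ioc_union_Ioi_eq_Ioi hx]
    exact ((intervalIntegrable_iff_integrableOn_Ioc_of_le hx).1 imid).union iright
  have vleft : ∫ y in Set.Iic 0, φ y =
      Real.exp (-x) * ((reverseBessel (n + 1)).eval 0 / (2 * (n + 1))) := by
    have h := integral_comp_neg_Ioi 0 φ
    rw [neg_zero] at h
    rw [← h, ← setIntegral_congr_fun measurableSet_Ioi hneg, integral_const_mul,
      integral_Ioi_reverseBessel_mul_exp n le_rfl]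
    simp
  have vmid : ∫ y in (0 : ℝ)..x, φ y = Real.exp (-x) *
      (((reverseBessel (n + 1)).eval x + x * (reverseBessel n).eval x) / (2 * (n + 1))
        - (reverseBessel (n + 1)).eval 0 / (2 * (n + 1))) := by
    rw [intervalIntegral.integral_congr hmid, intervalIntegral.integral_const_mul,
      intervalIntegral.integral_eq_sub_of_hasDerivAt
        (fun s _ ↦ hasDerivAt_reverseBessel_add n s)
        ((reverseBessel n).continuous.intervalIntegrable _ _)]
    simp
  have vright : ∫ y in Set.Ioi x, φ y = Real.exp (-x) *
      (((reverseBessel (n + 1)).eval x - x * (reverseBessel n).eval x) / (2 * (n + 1))) := by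
    have h : Real.exp (-x) = Real.exp x * Real.exp (-2 * x) := by
      rw [← Real.exp_add]; ring_nf
    rw [← setIntegral_congr_fun measurableSet_Ioi hpos, integral_const_mul,
      integral_Ioi_reverseBessel_mul_exp n hx, h]
    ring
  rw [← intervalIntegral.integral_Iic_add_Ioi ileft ipos,
    ← intervalIntegral.integral_interval_add_Ioi ipos iright, vleft, vmid, vright,
    besselDensity, abs_of_nonneg hx]
  field_simp
  ring

theorem integral_besselDensity_mul_exp (n : ℕ) (x : ℝ) :
    ∫ y, besselDensity n y * Real.exp (-|x - y|) = besselDensity (n + 1) x / (n + 1) := by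
  rcases le_total 0 x with hx | hx
  · exact integral_besselDensity_mul_exp_of_nonneg n hx
  · rw [← besselDensity_neg (n + 1),
      ← integral_besselDensity_mul_exp_of_nonneg n (neg_nonneg.2 hx),
      ← integral_neg_eq_self]
    refine integral_congr_ae (.of_forall fun y ↦ ?_)
    simp only [besselDensity_neg, sub_neg_eq_add]
    rw [← abs_neg, neg_add, sub_eq_add_neg]

theorem integral_besselDensity_sub_mul_exp (n : ℕ) (x : ℝ) :
    ∫ y, besselDensity n (x - y) * Real.exp (-|y|) = besselDensity (n + 1) x / (n + 1) := by
  rw [← integral_besselDensity_mul_exp, ← integral_sub_left_eq_self _ volume x]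
  simp

theorem iterated_convolution_exp_neg_abs_eq {C μ : ℝ} (hμ : 0 < μ) {g : ℕ → ℝ → ℝ}
    (hg0 : ∀ ξ : ℝ, g 0 ξ = C * Real.exp (-μ * |ξ|))
    (hgsucc : ∀ (n : ℕ) (ξ : ℝ),
      g (n + 1) ξ = (1 / (2 * Real.pi)) * ∫ η : ℝ, g n (ξ - η) * g 0 η) (n : ℕ) (ξ : ℝ) :
    g n ξ = C * (C / (2 * Real.pi * μ)) ^ n / n.factorial * besselDensity n (μ * ξ) := by
  induction n generalizing ξ with
  | zero => simp [hg0, besselDensity, reverseBessel, abs_mul, abs_of_pos hμ]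
  | succ n ih =>
    have h (η : ℝ) : g n (ξ - η) * g 0 η =
        C * (C * (C / (2 * Real.pi * μ)) ^ n / n.factorial) *
          (fun y ↦ besselDensity n (μ * ξ - y) * Real.exp (-|y|)) (μ * η) := by
      simp only [ih, hg0, abs_mul, abs_of_pos hμ, mul_sub, neg_mul]
      ring
    rw [hgsucc]
    simp_rw [h]
    rw [integral_const_mul, Measure.integral_comp_mul_left
      (fun y ↦ besselDensity n (μ * ξ - y) * Real.exp (-|y|)), integral_besselDensity_sub_mul_exp,
      smul_eq_mul, abs_of_pos (inv_pos.2 hμ), Nat.factorial_succ, pow_succ]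
    push_cast
    field_simp

/-- Formula `spectrum:S2:gmbound`: Gamma function bound on the
iterated convolutions of `C·exp(−μ|ξ|)`. -/
theorem stmt_18
    (C μ : ℝ) (hC : 0 < C) (hμ : 0 < μ)
    (g : ℕ → ℝ → ℝ)
    (hg0 : ∀ ξ : ℝ, g 0 ξ = C * Real.exp (-μ * |ξ|))
    (hgsucc : ∀ (n : ℕ) (ξ : ℝ),
      g (n + 1) ξ = (1 / (2 * Real.pi)) * ∫ η : ℝ, g n (ξ - η) * g 0 η) :
    ∀ (n : ℕ) (ξ : ℝ),
      g n ξ ≤ C * Real.exp (-μ * |ξ|) * (C / (Real.pi * μ)) ^ n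
        * Real.Gamma ((1 + μ * |ξ|) / 2 + (n : ℝ))
        / (Real.Gamma ((n : ℝ) + 1) * Real.Gamma ((1 + μ * |ξ|) / 2)) := by
  intro n ξ
  have ht : 0 ≤ μ * |ξ| := by positivity
  rw [iterated_convolution_exp_neg_abs_eq hμ hg0 hgsucc, besselDensity, abs_mul, abs_of_pos hμ,
    Real.Gamma_nat_eq_factorial]
  have hle := mul_le_mul_of_nonneg_left (reverseBessel_eval_le_Gamma n ht)
    (show 0 ≤ C * (C / (2 * Real.pi * μ)) ^ n / n.factorial * Real.exp (-μ * |ξ|) by positivity)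
  have hpow : (C / (Real.pi * μ)) ^ n = (C / (2 * Real.pi * μ)) ^ n * 2 ^ n := by
    rw [← mul_pow]
    congr 1
    field_simp
  rw [hpow, ← neg_mul]
  refine le_of_eq_of_le ?_ (hle.trans_eq ?_)
  · ring
  · have hpos : 0 < Real.Gamma ((1 + μ * |ξ|) / 2) := Real.Gamma_pos_of_pos (by positivity)
    field_simp

end
end
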